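/- There exists a constant C > 0 such that for all integers n ≥ 0 and all integers k ≥ 1, |μ_{n,k} − (2^k/Q_k)(1 − 2^{−k})^n| ≤ C · (2^k/Q_k)(1 − 2^{−k})^n · e^{−n/(2^k − 1)}. -/

import Mathlib

open Filter Real

/-- `Q j = ∏_{ℓ=1}^{j} (1 - 2^{-ℓ})`. -/
noncomputable def Q (j : ℕ) : ℝ := ∏ l ∈ Finset.range j, (1 - (2:ℝ)^(-(l:ℤ)-1))

/-- Expected external profile `μ_{n,k}`. -/
noncomputable def mu : ℕ → ℕ → ℝ
  | n, 0 => if n = 0 then 1 else 0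
  | n, k + 1 => (2:ℝ)^((2:ℤ) - (n:ℤ)) *
      ∑ j ∈ Finset.range n, ((n-1).choose j : ℝ) * mu j k

lemma zpow_half (k : ℕ) : (2:ℝ)^(-(k:ℤ)) = (1/2)^k := by
  rw [zpow_neg, zpow_natCast, one_div, inv_pow]

lemma Q_zero' : Q 0 = 1 := by simp [Q]

lemma Q_succ' (j : ℕ) : Q (j+1) = Q j * (1 - (1/2)^(j+1)) := by
  unfold Q
  rw [Finset.prod_range_succ, ← zpow_half]
  congr 3
  push_cast; ring

lemma half_lt (j : ℕ) : (1/2:ℝ)^(j+1) < 1 := pow_lt_one₀ (by norm_num) (by norm_num) (by omega)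

lemma Q_pos' (j : ℕ) : 0 < Q j := by
  induction j with
  | zero => simp [Q_zero']
  | succ j ih => rw [Q_succ']; exact mul_pos ih (by linarith [half_lt j])

lemma Q_anti' : Antitone Q := by
  apply antitone_nat_of_succ_le
  intro j
  rw [Q_succ']
  have := Q_pos' j
  have : (0:ℝ) < (1/2)^(j+1) := by positivity
  nlinarith

lemma Q_lower (j : ℕ) : 1/4 + (1/2)^(j+1+1) ≤ Q (j+1) := by
  induction j with
  | zero => rw [Q_succ', Q_zero']; norm_num
  | succ j ih =>
    rw [Q_succ']
    have h1 : (0:ℝ) < (1/2)^(j+1+1) := by positivity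
    have h2 : (1/2:ℝ)^(j+1+1) ≤ 1/4 := by
      have := pow_le_pow_of_le_one (by norm_num : (0:ℝ) ≤ 1/2) (by norm_num) (by omega : 2 ≤ j+1+1)
      norm_num at this ⊢; exact this
    have h3 : (1/2:ℝ)^(j+1+1+1) = (1/2)^(j+1+1) * (1/2) := pow_succ _ _
    rw [h3]
    nlinarith [mul_le_mul_of_nonneg_right ih (by linarith : 0 ≤ 1 - (1/2:ℝ)^(j+1+1))]

lemma Q_ge (j : ℕ) : 1/4 ≤ Q j := by
  cases j with
  | zero => rw [Q_zero']; norm_num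
  | succ j =>
    have := Q_lower j
    have : (0:ℝ) < (1/2)^(j+1+1) := by positivity
    linarith

noncomputable def ee (m : ℕ) : ℝ := (-1)^m * (1/2)^(m.choose 2) / Q m

lemma tele (M : ℕ) : ∀ r : ℕ, ∑ m ∈ Finset.range (M+1), ee m / Q (M+1+r-m) =
    (-1)^M * (1/2)^((M+1).choose 2) / (Q r * Q M * (1 - (1/2)^(M+1+r))) := by
  induction M with
  | zero =>
    intro r
    have : Q (1+r) = Q r * (1 - (1/2)^(1+r)) := by rw [add_comm 1 r, Q_succ']
    simp [ee, Q_zero', this]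
  | succ M ih =>
    intro r
    rw [Finset.sum_range_succ]
    have h := ih (r+1)
    have e1 : ∀ m, M+1+1+r-m = M+1+(r+1)-m := by intro m; omega
    simp only [e1]
    rw [h]
    have e2 : M+1+(r+1)-(M+1) = r+1 := by omega
    have e3 : (M+1+1).choose 2 = (M+1).choose 2 + (M+1) := by
      rw [Nat.choose_succ_succ' (M+1) 1, Nat.choose_one_right, add_comm]
    rw [e2, ee, e3, Q_succ' r, Q_succ' M]
    have hr := (Q_pos' r).ne'
    have hM := (Q_pos' M).ne'
    have a1 : (1 - (1/2:ℝ)^(r+1)) ≠ 0 := (sub_pos.2 (half_lt r)).ne'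
    have a2 : (1 - (1/2:ℝ)^(M+1)) ≠ 0 := (sub_pos.2 (half_lt M)).ne'
    have a3 : (1 - (1/2:ℝ)^(M+1+(r+1))) ≠ 0 := (sub_pos.2 (half_lt (M+1+r))).ne'
    have e5 : (1/2:ℝ)^(M+1+1+r) = (1/2)^(M+1+(r+1)) := by congr 1; omega
    rw [e5]
    have e4 : (1/2:ℝ)^(M+1+(r+1)) = (1/2)^(M+1) * (1/2)^(r+1) := pow_add _ _ _
    rw [pow_add (1/2:ℝ) ((M+1).choose 2), pow_succ (-1:ℝ)]
    rw [e4] at a3 ⊢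
    generalize (1/2:ℝ)^(M+1) = u at *
    generalize (1/2:ℝ)^(r+1) = v at *
    generalize (1/2:ℝ)^((M+1).choose 2) = w at *
    generalize (-1:ℝ)^M = s at *
    generalize Q r = x at *
    generalize Q M = y at *
    clear h ih e4 e5 e3 e2 e1
    rw [div_div, div_add_div _ _ (by positivity) (by positivity),
      div_eq_div_iff (by positivity) (by positivity)]
    ring

lemma sum_zero (k : ℕ) : ∑ m ∈ Finset.range (k+1+1), ee m / Q (k+1-m) = 0 := by
  rw [Finset.sum_range_succ]
  have h := tele k 0
  simp only [add_zero] at h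
  rw [h, Nat.sub_self, Q_zero', ee, Q_succ', pow_succ (-1:ℝ)]
  ring

lemma mu_formula (k : ℕ) : ∀ n, mu n k =
    ∑ j ∈ Finset.range (k+1), 2^k * (ee (k-j) / Q j) * (1 - (1/2:ℝ)^j)^n := by
  induction k with
  | zero =>
    intro n
    rw [mu]
    simp [ee, Q_zero', zero_pow_eq]
  | succ k ih =>
    intro n
    rw [mu]
    cases n with
    | zero =>
      have h := sum_zero k
      rw [← Finset.sum_range_reflect] at h
      simp only [Finset.range_zero, Finset.sum_empty, mul_zero, pow_zero, mul_one]
      rw [← Finset.mul_sum]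
      symm
      rw [mul_eq_zero]; right
      rw [← h]
      apply Finset.sum_congr rfl
      intro j hj
      rw [Finset.mem_range] at hj
      have e1 : k+1+1-1-j = k+1-j := by omega
      have e2 : k+1-(k+1-j) = j := by omega
      rw [e1, e2]
    | succ n =>
      rw [Finset.sum_range_succ' _ (k+1)]
      simp only [ih, Nat.add_sub_cancel, Finset.mul_sum]
      rw [Finset.sum_comm]
      simp only [pow_zero, sub_self, zero_pow (Nat.succ_ne_zero n), mul_zero, add_zero]
      apply Finset.sum_congr rfl
      intro i hi
      have hb : ∑ j ∈ Finset.range (n+1), (n.choose j : ℝ) * (1 - (1/2:ℝ)^i)^j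
          = 2^n * (1 - (1/2:ℝ)^(i+1))^n := by
        rw [← mul_pow]
        have : (2 * (1 - (1/2:ℝ)^(i+1))) = (1 - (1/2:ℝ)^i) + 1 := by rw [pow_succ]; ring
        rw [this, add_pow]
        apply Finset.sum_congr rfl
        intro j _
        simp; ring
      have hz : (2:ℝ)^((2:ℤ) - ((n+1:ℕ):ℤ)) = 2 / 2^n := by
        rw [show (2:ℤ) - ((n+1:ℕ):ℤ) = 1 - (n:ℤ) by push_cast; ring, zpow_sub₀ (by norm_num)]
        simp
      calc _ = (2:ℝ)^((2:ℤ) - ((n+1:ℕ):ℤ)) * (2^k * (ee (k-i) / Q i)) *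
            ∑ j ∈ Finset.range (n+1), (n.choose j : ℝ) * (1 - (1/2:ℝ)^i)^j := by
              rw [Finset.mul_sum]
              apply Finset.sum_congr rfl
              intro j _
              ring
        _ = _ := by
          rw [hb, hz, Q_succ', show k+1-(i+1) = k-i by omega]
          have a1 := (sub_pos.2 (half_lt i)).ne'
          have a2 := (Q_pos' i).ne'
          generalize (1/2:ℝ)^(i+1) = u at *
          field_simp
          ring

lemma ee_bound (m : ℕ) : |ee (m+1)| ≤ 4 * (1/2)^m := by
  rw [ee, abs_div, abs_mul, abs_pow, abs_neg, abs_one, one_pow, one_mul, abs_of_pos (Q_pos' _),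
    abs_of_nonneg (by positivity), div_le_iff₀ (Q_pos' _)]
  have h1 : (1/2:ℝ)^((m+1).choose 2) ≤ (1/2)^m := by
    apply pow_le_pow_of_le_one (by norm_num) (by norm_num)
    rw [Nat.choose_succ_succ' m 1, Nat.choose_one_right]; omega
  have h2 := Q_ge (m+1)
  have h3 : (0:ℝ) < (1/2)^m := by positivity
  nlinarith

lemma ratio_bound (k j n : ℕ) (hj : j < k) :
    (1 - (1/2:ℝ)^j)^n ≤ (1 - (1/2:ℝ)^k)^n * Real.exp (-(n:ℝ) / ((2:ℝ)^k - 1)) := by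
  have e : Real.exp (-(n:ℝ) / ((2:ℝ)^k - 1)) = (Real.exp (-1 / ((2:ℝ)^k - 1)))^n := by
    rw [← Real.exp_nat_mul]; congr 1; ring
  rw [e, ← mul_pow]
  have hjle : (1/2:ℝ)^j ≤ 1 := pow_le_one₀ (by norm_num) (by norm_num)
  apply pow_le_pow_left₀ (by linarith)
  obtain ⟨i, rfl⟩ : ∃ i, k = i+1 := ⟨k-1, by omega⟩
  have hk : (1:ℝ) < 2^(i+1) := one_lt_pow₀ (by norm_num) (by omega)
  have h1 := Real.add_one_le_exp (-1 / ((2:ℝ)^(i+1) - 1))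
  have h2 := half_lt i
  have h3 : (1/2:ℝ)^i ≤ (1/2)^j := pow_le_pow_of_le_one (by norm_num) (by norm_num) (by omega)
  calc 1 - (1/2:ℝ)^j ≤ 1 - (1/2)^i := by linarith
    _ = (1 - (1/2:ℝ)^(i+1)) * (-1 / ((2:ℝ)^(i+1) - 1) + 1) := by
      have hz : (2:ℝ)^(i+1) - 1 ≠ 0 := by linarith
      have e2 : (1/2:ℝ)^(i+1) = 1 / 2^(i+1) := by rw [one_div_pow]
      have e3 : (1/2:ℝ)^i = 2 / 2^(i+1) := by rw [one_div_pow, pow_succ]; field_simp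
      rw [e2, e3]
      have : (2:ℝ)^(i+1) ≠ 0 := by positivity
      generalize (2:ℝ)^(i+1) = u at *
      field_simp
      ring
    _ ≤ _ := mul_le_mul_of_nonneg_left h1 (by linarith)

lemma geom_bound (k : ℕ) : ∑ m ∈ Finset.range k, 4 * (1/2:ℝ)^m ≤ 8 := by
  rw [← Finset.mul_sum, geom_sum_eq (by norm_num)]
  have h : (0:ℝ) < (1/2)^k := by positivity
  have e : 4 * (((1/2:ℝ)^k - 1) / (1/2 - 1)) = 8 - 8 * (1/2)^k := by ring
  rw [e]; linarith

/-- `μ_{n,k} = (2^k/Q_k)(1 − 2^{−k})^n (1 + O(e^{−n/(2^k−1)}))` uniformly for `k ≥ 1`. -/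
theorem mu_asymptotic_small_k : ∃ C > (0:ℝ), ∀ n k : ℕ, 1 ≤ k →
    |mu n k - (2:ℝ)^k / Q k * (1 - (2:ℝ)^(-(k:ℤ)))^n| ≤
      C * ((2:ℝ)^k / Q k * (1 - (2:ℝ)^(-(k:ℤ)))^n) *
        Real.exp (-(n:ℝ) / ((2:ℝ)^k - 1)) := by
  refine ⟨8, by norm_num, ?_⟩
  intro n k _
  rw [zpow_half, mu_formula, Finset.sum_range_succ]
  have e0 : (2:ℝ)^k * (ee (k-k) / Q k) = 2^k / Q k := by
    simp [ee, Q_zero']; ring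
  rw [e0, add_sub_cancel_right]
  set X := (1 - (1/2:ℝ)^k)^n * Real.exp (-(n:ℝ) / ((2:ℝ)^k - 1)) with hX
  have hX0 : 0 ≤ X := by
    have : (1/2:ℝ)^k ≤ 1 := pow_le_one₀ (by norm_num) (by norm_num)
    have : 0 ≤ 1 - (1/2:ℝ)^k := by linarith
    positivity
  have hQk := Q_pos' k
  calc _ ≤ ∑ j ∈ Finset.range k, |2^k * (ee (k-j) / Q j) * (1 - (1/2:ℝ)^j)^n| :=
        Finset.abs_sum_le_sum_abs _ _
    _ ≤ ∑ j ∈ Finset.range k, (4 * (1/2:ℝ)^(k-1-j)) * (2^k / Q k * X) := by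
        apply Finset.sum_le_sum
        intro j hj
        rw [Finset.mem_range] at hj
        have b1 := ee_bound (k-1-j)
        rw [show k-1-j+1 = k-j by omega] at b1
        have b2 := ratio_bound k j n hj
        have hjle : (1/2:ℝ)^j ≤ 1 := pow_le_one₀ (by norm_num) (by norm_num)
        have b3 : 0 ≤ (1 - (1/2:ℝ)^j)^n := pow_nonneg (by linarith) _
        have b4 : Q k ≤ Q j := Q_anti' hj.le
        have hQj := Q_pos' j
        rw [abs_mul, abs_mul, abs_div, abs_of_pos hQj, abs_of_nonneg b3,
          abs_of_pos (by positivity : (0:ℝ) < 2^k)]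
        calc (2:ℝ)^k * (|ee (k-j)| / Q j) * (1 - (1/2:ℝ)^j)^n
            ≤ 2^k * ((4 * (1/2:ℝ)^(k-1-j)) / Q k) * X := by gcongr
          _ = _ := by ring
    _ = (∑ m ∈ Finset.range k, 4 * (1/2:ℝ)^m) * (2^k / Q k * X) := by
        rw [← Finset.sum_mul, Finset.sum_range_reflect (fun m => 4 * (1/2:ℝ)^m)]
    _ ≤ 8 * (2^k / Q k * X) := mul_le_mul_of_nonneg_right (geom_bound k) (by positivity)
    _ = _ := by rw [hX]; ring
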